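/- Let G be a finite simple undirected graph with edge weights w: E(G) → [0,∞), let k ≥ 1, and let →G, G', q be as in the subdivision construction. Let (V₁,…,V_k) be a partition of V(G), and define f: V(G') → {1,…,k} by f(v) = i for every v ∈ V_i and f(a(v,u)) = i for every subdivision vertex a(v,u) with v ∈ V_i. Then Δ(f,q,G') = Σ of w({v,u}) over all edges {v,u} of G whose two endpoints lie in different parts of the partition (V₁,…,V_k). -/

import Mathlib

open scoped Classical
open Finset

noncomputable section

/-- Transfer cost `Δ(f, q, G)` of an assignment `f` of the vertices of a digraph with
arc relation `A` to `k` machines. -/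
def transferCost {V : Type*} [Fintype V] (A : V → V → Prop) (k : ℕ)
    (f : V → Fin k) (q : V → ENNReal) : ENNReal :=
  ∑ i : Fin k, ∑ v ∈ Finset.univ.filter (fun v => f v = i),
    ∑ j ∈ Finset.univ.filter (fun j => j ≠ i),
      if ∃ u, A v u ∧ f u = j then q v else 0

/-- Vertices of the subdivided DAG `G'`: original vertices together with one
subdivision vertex `a(v,u)` for every arc `(v,u)` of `→G` (the orientation of `G`
from smaller to larger endpoint). -/
abbrev SubVertex {V : Type*} (G : SimpleGraph V) [LinearOrder V] :=
  V ⊕ {p : V × V // G.Adj p.1 p.2 ∧ p.1 < p.2}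

/-- Arcs of `G'`: `(v, a(v,u))` and `(a(v,u), u)` for every arc `(v,u)` of `→G`. -/
def subArc {V : Type*} (G : SimpleGraph V) [LinearOrder V] :
    SubVertex G → SubVertex G → Prop
  | Sum.inl v, Sum.inr a => a.1.1 = v
  | Sum.inr a, Sum.inl u => a.1.2 = u
  | _, _ => False

/-- The function `q` on `V(G')`: `∞` on original vertices, `w({v,u})` on `a(v,u)`. -/
def subQ {V : Type*} (G : SimpleGraph V) [LinearOrder V] (w : Sym2 V → NNReal) :
    SubVertex G → ENNReal
  | Sum.inl _ => ⊤
  | Sum.inr a => (w s(a.1.1, a.1.2) : ENNReal)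

/-- The function `p` on `V(G') × [k]`: `p(t_j, i) = ∞` whenever `i ≠ j`, and `0` otherwise. -/
def subP {V : Type*} (G : SimpleGraph V) [LinearOrder V] {k : ℕ} (t : Fin k → V) :
    SubVertex G → Fin k → ENNReal :=
  fun x i => match x with
    | Sum.inl v => if ∃ j : Fin k, t j = v ∧ j ≠ i then ⊤ else 0
    | Sum.inr _ => 0

/-- The contribution of a single vertex `v` to the transfer cost. -/
def vertexTransferCost {V : Type*} (A : V → V → Prop) {k : ℕ}
    (f : V → Fin k) (q : V → ENNReal) (v : V) : ENNReal :=
  ∑ j, if j ≠ f v ∧ ∃ u, A v u ∧ f u = j then q v else 0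

theorem transferCost_eq_sum {V : Type*} [Fintype V] (A : V → V → Prop) (k : ℕ)
    (f : V → Fin k) (q : V → ENNReal) :
    transferCost A k f q = ∑ v, vertexTransferCost A f q v := by
  unfold transferCost
  rw [← Finset.sum_fiberwise Finset.univ f]
  refine Finset.sum_congr rfl fun i _ => Finset.sum_congr rfl fun v hv => ?_
  obtain rfl := (Finset.mem_filter.mp hv).2
  rw [Finset.sum_filter, vertexTransferCost]
  exact Finset.sum_congr rfl fun _ _ => by rw [ite_and]; congr

/-- A vertex whose out-neighbors all lie on its own machine costs nothing. -/
theorem vertexTransferCost_eq_zero {V : Type*} {A : V → V → Prop} {k : ℕ} {f : V → Fin k}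
    {v : V} (h : ∀ u, A v u → f u = f v) (q : V → ENNReal) :
    vertexTransferCost A f q v = 0 :=
  Finset.sum_eq_zero fun _ _ => if_neg fun ⟨hj, u, hu, huj⟩ => hj (huj ▸ h u hu)

/-- A vertex with exactly one out-neighbor pays at most once. -/
theorem vertexTransferCost_of_unique {V : Type*} {A : V → V → Prop} {k : ℕ} (f : V → Fin k)
    {v u : V} (h : ∀ x, A v x ↔ x = u) (q : V → ENNReal) :
    vertexTransferCost A f q v = if f v ≠ f u then q v else 0 := by
  rw [vertexTransferCost, Finset.sum_eq_single (f u)]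
  · simp [h, eq_comm]
  · rintro j - hj
    simp [h, hj.symm]
  · simp

theorem subArc_inl {V : Type*} (G : SimpleGraph V) [LinearOrder V] {v : V} {x : SubVertex G}
    (h : subArc G (Sum.inl v) x) : ∃ a, x = Sum.inr a ∧ a.1.1 = v := by
  rcases x with u | a
  · exact h.elim
  · exact ⟨a, rfl, h⟩

theorem subArc_inr_iff {V : Type*} (G : SimpleGraph V) [LinearOrder V]
    (a : {p : V × V // G.Adj p.1 p.2 ∧ p.1 < p.2}) (x : SubVertex G) :
    subArc G (Sum.inr a) x ↔ x = Sum.inl a.1.2 := by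
  rcases x with u | b
  · simp [subArc, eq_comm]
  · simp [subArc]


theorem stmt1 {V : Type*} [Fintype V] [LinearOrder V] (G : SimpleGraph V)
    (w : Sym2 V → NNReal) (k : ℕ) (hk : 1 ≤ k) (g : V → Fin k) :
    transferCost (subArc G) k
      (fun x : SubVertex G => match x with
        | Sum.inl v => g v
        | Sum.inr a => g a.1.1)
      (subQ G w)
    =
    ∑ v : V, ∑ u : V,
      if G.Adj v u ∧ v < u ∧ g v ≠ g u then (w s(v, u) : ENNReal) else 0 := by
  rw [transferCost_eq_sum, Fintype.sum_sum_type, Finset.sum_eq_zero, zero_add]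
  · rw [Finset.sum_congr rfl fun a _ =>
      vertexTransferCost_of_unique _ (subArc_inr_iff G a) _]
    trans ∑ p : V × V with G.Adj p.1 p.2 ∧ p.1 < p.2,
      if g p.1 ≠ g p.2 then (w s(p.1, p.2) : ENNReal) else 0
    · symm
      exact Finset.sum_subtype _ (fun p => Finset.mem_filter_univ p)
        fun p : V × V => if g p.1 ≠ g p.2 then (w s(p.1, p.2) : ENNReal) else 0
    · rw [← Fintype.sum_prod_type', Finset.sum_filter]
      refine Finset.sum_congr rfl fun p _ => ?_
      rw [← ite_and]
      simp only [and_assoc]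
  · refine fun v _ => vertexTransferCost_eq_zero (fun x hx => ?_) _
    obtain ⟨a, rfl, rfl⟩ := subArc_inl G hx
    rfl
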